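/- Let K₁ and K₂ be nondegenerate tetrahedra in ℝ³ that share a common face f, and let n be a unit normal vector to f. Let σ₁ ∈ Σ_{K₁} and σ₂ ∈ Σ_{K₂}. If ∫_f (σ₁ − σ₂) n · v ds = 0 for every v ∈ P₁(f; ℝ³), then nᵀ σ₁ n = nᵀ σ₂ n at every point of f; that is, the normal–normal component of the stress is continuous across the shared face. -/

import Mathlib

open MeasureTheory RealInnerProductSpace Matrix

noncomputable section

abbrev E3 := EuclideanSpace ℝ (Fin 3)

/-- `p` is (the restriction of) a real polynomial of total degree ≤ k on ℝ³. -/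
def IsPolyLE (k : ℕ) (p : E3 → ℝ) : Prop :=
  ∃ P : MvPolynomial (Fin 3) ℝ, P.totalDegree ≤ k ∧ ∀ x, p x = MvPolynomial.eval (fun i => x i) P

/-- `p` agrees with an affine function on the set `s`. -/
def AffineOn (s : Set E3) (p : E3 → ℝ) : Prop :=
  ∃ q : E3 →ᵃ[ℝ] ℝ, ∀ x ∈ s, p x = q x

def Tet (v : Fin 4 → E3) : Set E3 := convexHull ℝ (Set.range v)

def Face (v : Fin 4 → E3) (i : Fin 4) : Set E3 := convexHull ℝ (v '' {j | j ≠ i})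

def Edge (v : Fin 4 → E3) (k l : Fin 4) : Set E3 := segment ℝ (v k) (v l)

/-- The matrix of the orthogonal projection `Q_u = I - u uᵀ` onto the plane `u^⊥`. -/
def Qmat (u : E3) : Matrix (Fin 3) (Fin 3) ℝ :=
  1 - Matrix.vecMulVec (fun i => u i) (fun i => u i)

/-- Membership in the shape-function space
`Σ_K = {σ ∈ P₂(K;𝕊) : Q_{s_e} σ Q_{s_e}|_e ∈ P₁(e;𝕊) for every edge e of K}`. -/
def MemSigmaK (v : Fin 4 → E3) (σ : E3 → Matrix (Fin 3) (Fin 3) ℝ) : Prop :=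
  (∀ i j : Fin 3, IsPolyLE 2 (fun x => σ x i j)) ∧
  (∀ x ∈ Tet v, (σ x).IsSymm) ∧
  (∀ k l : Fin 4, k ≠ l → ∀ s : E3, ‖s‖ = 1 → (∃ c : ℝ, v l - v k = c • s) →
    ∀ i j : Fin 3, AffineOn (Edge v k l) (fun x => (Qmat s * σ x * Qmat s) i j))

/-- Functions of degree at most two, in coordinate-free form. -/
def IsQ (g : E3 → ℝ) : Prop :=
  ∃ (c : ℝ) (l : E3 →ₗ[ℝ] ℝ) (M : E3 →ₗ[ℝ] E3 →ₗ[ℝ] ℝ), ∀ x, g x = c + l x + M x x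

lemma IsQ.add {f g : E3 → ℝ} (hf : IsQ f) (hg : IsQ g) : IsQ (fun x => f x + g x) := by
  obtain ⟨c, l, M, h⟩ := hf
  obtain ⟨c', l', M', h'⟩ := hg
  refine ⟨c + c', l + l', M + M', fun x => ?_⟩
  simp only [h, h', LinearMap.add_apply]
  ring

lemma IsQ.smul {f : E3 → ℝ} (a : ℝ) (hf : IsQ f) : IsQ (fun x => a * f x) := by
  obtain ⟨c, l, M, h⟩ := hf
  refine ⟨a * c, a • l, a • M, fun x => ?_⟩
  simp only [h, LinearMap.smul_apply, smul_eq_mul]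
  ring

lemma IsQ.const (a : ℝ) : IsQ (fun _ => a) := ⟨a, 0, 0, fun x => by simp⟩

lemma IsQ.lin (l : E3 →ₗ[ℝ] ℝ) : IsQ (fun x => l x) := ⟨0, l, 0, fun x => by simp⟩

lemma IsQ.mul (l m : E3 →ₗ[ℝ] ℝ) : IsQ (fun x => l x * m x) :=
  ⟨0, 0, l.smulRight m, fun x => by simp⟩

lemma IsQ.sum {ι : Type*} (s : Finset ι) (f : ι → E3 → ℝ) (h : ∀ i ∈ s, IsQ (f i)) :
    IsQ (fun x => ∑ i ∈ s, f i x) := by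
  classical
  induction s using Finset.induction_on with
  | empty => simpa using IsQ.const 0
  | insert a s ha ih =>
    simp only [Finset.sum_insert ha]
    exact (h a (by simp)).add (ih fun i hi => h i (by simp [hi]))

/-- Coordinate functional. -/
def cx (i : Fin 3) : E3 →ₗ[ℝ] ℝ := (EuclideanSpace.proj i : E3 →L[ℝ] ℝ).toLinearMap

lemma cx_apply (i : Fin 3) (x : E3) : cx i x = x i := rfl

lemma IsQ.mono (i j k : ℕ) (h : i + j + k ≤ 2) :
    IsQ (fun x => cx 0 x ^ i * cx 1 x ^ j * cx 2 x ^ k) := by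
  have hi : i ≤ 2 := by omega
  have hj : j ≤ 2 := by omega
  have hk : k ≤ 2 := by omega
  interval_cases i <;> interval_cases j <;> interval_cases k <;>
    first
    | (exfalso; omega)
    | (simp only [pow_zero, pow_one, one_mul, mul_one, pow_two]
       first
       | exact IsQ.const _
       | exact IsQ.lin _
       | exact IsQ.mul _ _)

lemma IsPolyLE.isQ {g : E3 → ℝ} (h : IsPolyLE 2 g) : IsQ g := by
  obtain ⟨P, hP, hg⟩ := h
  have : g = fun x => ∑ m ∈ P.support, MvPolynomial.coeff m P *
      (cx 0 x ^ m 0 * cx 1 x ^ m 1 * cx 2 x ^ m 2) := by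
    funext x
    rw [hg, MvPolynomial.eval_eq']
    simp [Fin.prod_univ_three, cx_apply]
  rw [this]
  refine IsQ.sum _ _ fun m hm => IsQ.smul _ (IsQ.mono _ _ _ ?_)
  have := (MvPolynomial.le_totalDegree hm).trans hP
  rwa [Finsupp.sum_fintype _ _ (by simp), Fin.sum_univ_three] at this

/-- normal-normal component -/
def nn (n : E3) (A : Matrix (Fin 3) (Fin 3) ℝ) : ℝ :=
  (fun r => n r) ⬝ᵥ (A.mulVec (fun r => n r))

lemma nn_eq (n : E3) (A : Matrix (Fin 3) (Fin 3) ℝ) :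
    nn n A = ∑ i, ∑ j, (n i * n j) * A i j := by
  simp only [nn, dotProduct, mulVec, Finset.mul_sum]
  refine Finset.sum_congr rfl fun i _ => Finset.sum_congr rfl fun j _ => by ring

lemma nn_isQ (n : E3) (σ : E3 → Matrix (Fin 3) (Fin 3) ℝ)
    (h : ∀ i j : Fin 3, IsPolyLE 2 (fun x => σ x i j)) : IsQ (fun x => nn n (σ x)) := by
  simp only [nn_eq]
  exact IsQ.sum _ _ fun i _ => IsQ.sum _ _ fun j _ => (h i j).isQ.smul _

lemma Q_mulVec (s n : E3) (h : ⟪s, n⟫ = 0) : (Qmat s).mulVec (fun r => n r) = fun r => n r := by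
  have h' : s 0 * n 0 + s 1 * n 1 + s 2 * n 2 = 0 := by
    rw [← h]; simp [PiLp.inner_apply, Fin.sum_univ_three, mul_comm]
  have h2 : (fun i => s i) ⬝ᵥ (fun r => n r) = 0 := by
    simpa [dotProduct, Fin.sum_univ_three] using h'
  rw [Qmat, Matrix.sub_mulVec, Matrix.one_mulVec, Matrix.vecMulVec_mulVec, h2]
  simp

lemma vecMul_Q (s n : E3) (h : ⟪s, n⟫ = 0) : Matrix.vecMul (fun r => n r) (Qmat s) = fun r => n r := by
  have : (Qmat s)ᵀ = Qmat s := by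
    simp [Qmat, Matrix.transpose_sub, Matrix.transpose_vecMulVec]
  rw [← Matrix.mulVec_transpose, this, Q_mulVec s n h]

lemma nn_Q (s n : E3) (h : ⟪s, n⟫ = 0) (A : Matrix (Fin 3) (Fin 3) ℝ) :
    nn n (Qmat s * A * Qmat s) = nn n A := by
  rw [nn, nn, ← Matrix.mulVec_mulVec, ← Matrix.mulVec_mulVec, Q_mulVec s n h,
    Matrix.dotProduct_mulVec, vecMul_Q s n h]

lemma edge_mid (v : Fin 4 → E3) (σ : E3 → Matrix (Fin 3) (Fin 3) ℝ) (hσ : MemSigmaK v σ)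
    (n : E3) (k l : Fin 4) (hkl : k ≠ l) (hv : v k ≠ v l) (hn : ⟪v l - v k, n⟫ = 0) :
    nn n (σ (midpoint ℝ (v k) (v l))) * 2 = nn n (σ (v k)) + nn n (σ (v l)) := by
  have hne : v l - v k ≠ 0 := sub_ne_zero.2 hv.symm
  have hne' : ‖v l - v k‖ ≠ 0 := norm_ne_zero_iff.2 hne
  set s : E3 := (‖v l - v k‖)⁻¹ • (v l - v k) with hs
  have hs1 : ‖s‖ = 1 := by rw [hs, norm_smul]; simp [hne']
  have hsn : ⟪s, n⟫ = 0 := by rw [hs, real_inner_smul_left, hn, mul_zero]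
  have key := hσ.2.2 k l hkl s hs1 ⟨‖v l - v k‖, by rw [hs, smul_inv_smul₀ hne']⟩
  choose q hq using key
  have hm : midpoint ℝ (v k) (v l) ∈ Edge v k l := midpoint_mem_segment _ _
  have hk : v k ∈ Edge v k l := left_mem_segment _ _ _
  have hl : v l ∈ Edge v k l := right_mem_segment _ _ _
  have e : ∀ x ∈ Edge v k l, nn n (σ x) = ∑ i, ∑ j, (n i * n j) * q i j x := by
    intro x hx
    rw [← nn_Q s n hsn, nn_eq]
    refine Finset.sum_congr rfl fun i _ => Finset.sum_congr rfl fun j _ => ?_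
    rw [← hq i j x hx]
  rw [e _ hm, e _ hk, e _ hl, Finset.sum_mul, ← Finset.sum_add_distrib]
  refine Finset.sum_congr rfl fun i _ => ?_
  rw [Finset.sum_mul, ← Finset.sum_add_distrib]
  refine Finset.sum_congr rfl fun j _ => ?_
  rw [AffineMap.map_midpoint, midpoint_eq_smul_add]
  simp only [smul_eq_mul, invOf_eq_inv]
  ring

/-- Reference triangle. -/
def T2 : Set (Fin 2 → ℝ) := {p | 0 ≤ p 0 ∧ 0 ≤ p 1 ∧ p 0 + p 1 ≤ 1}

lemma T2_convex : Convex ℝ T2 := by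
  rintro p ⟨h1, h2, h3⟩ q ⟨k1, k2, k3⟩ a b ha hb hab
  refine ⟨?_, ?_, ?_⟩ <;> simp only [Pi.add_apply, Pi.smul_apply, smul_eq_mul]
  · positivity
  · positivity
  · nlinarith [mul_le_mul_of_nonneg_left h3 ha, mul_le_mul_of_nonneg_left k3 hb]

lemma T2_closed : IsClosed T2 := by
  have h1 : IsClosed {p : Fin 2 → ℝ | 0 ≤ p 0} := isClosed_le (by fun_prop) (by fun_prop)
  have h2 : IsClosed {p : Fin 2 → ℝ | 0 ≤ p 1} := isClosed_le (by fun_prop) (by fun_prop)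
  have h3 : IsClosed {p : Fin 2 → ℝ | p 0 + p 1 ≤ 1} := isClosed_le (by fun_prop) (by fun_prop)
  exact h1.inter (h2.inter h3)

lemma T2_sub : T2 ⊆ Set.Icc 0 1 := by
  rintro p ⟨h1, h2, h3⟩
  refine ⟨fun i => ?_, fun i => ?_⟩ <;> fin_cases i <;> simp <;> linarith

lemma T2_compact : IsCompact T2 := isCompact_Icc.of_isClosed_subset T2_closed T2_sub

lemma T2_interior : (interior T2).Nonempty := by
  refine ⟨fun _ => 1/3, mem_interior.2 ⟨{p | 0 < p 0} ∩ ({p | 0 < p 1} ∩ {p | p 0 + p 1 < 1}),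
    ?_, ?_, ?_⟩⟩
  · rintro p ⟨h1, h2, h3⟩
    exact ⟨le_of_lt h1, le_of_lt h2, le_of_lt h3⟩
  · exact (isOpen_lt (by fun_prop) (by fun_prop)).inter
      ((isOpen_lt (by fun_prop) (by fun_prop)).inter (isOpen_lt (by fun_prop) (by fun_prop)))
  · refine ⟨?_, ?_, ?_⟩ <;> simp only [Set.mem_ofPred_eq] <;> norm_num

/-- Linear part of the parametrisation of a face. -/
def phiL (u v : E3) : (Fin 2 → ℝ) →ₗ[ℝ] E3 :=
  (LinearMap.proj 0 : (Fin 2 → ℝ) →ₗ[ℝ] ℝ).smulRight u +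
  (LinearMap.proj 1 : (Fin 2 → ℝ) →ₗ[ℝ] ℝ).smulRight v

def phi (x u v : E3) (p : Fin 2 → ℝ) : E3 := x + phiL u v p

lemma phi_eq (x u v : E3) (p : Fin 2 → ℝ) : phi x u v p = x + (p 0 • u + p 1 • v) := by
  simp [phi, phiL]

lemma hull_eq (w : Fin 3 → E3) :
    convexHull ℝ (Set.range w) = phi (w 0) (w 1 - w 0) (w 2 - w 0) '' T2 := by
  apply subset_antisymm
  · apply convexHull_min
    · rintro _ ⟨i, rfl⟩
      fin_cases i
      · exact ⟨![0, 0], by simp [T2], by simp [phi_eq]⟩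
      · exact ⟨![1, 0], by simp [T2], by simp [phi_eq]⟩
      · exact ⟨![0, 1], by simp [T2], by simp [phi_eq]⟩
    · have := (T2_convex.linear_image (phiL (w 1 - w 0) (w 2 - w 0))).translate (w 0)
      rwa [Set.image_image] at this
  · rintro _ ⟨p, ⟨h1, h2, h3⟩, rfl⟩
    have := (convex_convexHull ℝ (Set.range w)).sum_mem (t := Finset.univ)
      (w := ![1 - p 0 - p 1, p 0, p 1]) (z := w)
      (by intro i _; fin_cases i <;> simp <;> linarith)
      (by simp [Fin.sum_univ_three]; ring)
      (fun i _ => subset_convexHull ℝ _ ⟨i, rfl⟩)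
    convert this using 1
    rw [phi_eq, Fin.sum_univ_three]
    simp only [Matrix.cons_val]
    module

lemma phiL_inj (w : Fin 3 → E3) (a : E3) (hv : AffineIndependent ℝ ![w 0, w 1, w 2, a]) :
    LinearMap.ker (phiL (w 1 - w 0) (w 2 - w 0)) = ⊥ := by
  rw [LinearMap.ker_eq_bot']
  intro p hp
  have h0 : p 0 • (w 1 - w 0) + p 1 • (w 2 - w 0) = 0 := by simpa [phiL] using hp
  rw [affineIndependent_iff] at hv
  have := hv Finset.univ ![-p 0 - p 1, p 0, p 1, 0] (by simp [Fin.sum_univ_four]; ring)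
    (by
      rw [Fin.sum_univ_four, ← h0]
      simp only [Matrix.cons_val]
      module)
  have e1 := this 1 (by simp)
  have e2 := this 2 (by simp)
  simp only [Matrix.cons_val] at e1 e2
  funext i
  fin_cases i
  · exact e1
  · exact e2

lemma muH2 : (μH[2] : Measure (Fin 2 → ℝ)) = volume := by
  rw [← hausdorffMeasure_pi_real]; simp

lemma IsQ.continuous {g : E3 → ℝ} (h : IsQ g) : Continuous g := by
  obtain ⟨c, l, M, h⟩ := h
  have : g = fun x => c + l x + M x x := funext h
  rw [this]
  have h1 : Continuous l := l.continuous_of_finiteDimensional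
  have h2 : Continuous fun x => M x x := by
    have : Continuous fun x : E3 => LinearMap.toContinuousLinearMap (M x) :=
      (LinearMap.toContinuousLinearMap.toLinearMap ∘ₗ M).continuous_of_finiteDimensional
    exact this.clm_apply continuous_id
  exact (continuous_const.add h1).add h2

lemma vanish (w : Fin 3 → E3) (a : E3) (hv : AffineIndependent ℝ ![w 0, w 1, w 2, a])
    (g : E3 → ℝ) (hg : Continuous g)
    (h : ∫ x in convexHull ℝ (Set.range w), g x * g x ∂μH[2] = 0) :
    ∀ x ∈ convexHull ℝ (Set.range w), g x = 0 := by
  rw [hull_eq] at *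
  set L := phiL (w 1 - w 0) (w 2 - w 0) with hL
  obtain ⟨K, hK, hanti⟩ := L.exists_antilipschitzWith (phiL_inj w a hv)
  set φ := phi (w 0) (w 1 - w 0) (w 2 - w 0) with hφ
  have hφL : ∀ p, φ p = w 0 + L p := fun p => rfl
  have hLlip : LipschitzWith _ L := (LinearMap.toContinuousLinearMap L).lipschitz
  have hlip : LipschitzWith ‖LinearMap.toContinuousLinearMap L‖₊ φ := by
    intro p q
    rw [hφL, hφL, edist_add_left]
    exact hLlip p q
  have hanti' : AntilipschitzWith K φ := by
    intro p q
    rw [hφL, hφL, edist_add_left]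
    exact hanti p q
  have hcomp : IsCompact (φ '' T2) := T2_compact.image hlip.continuous
  have hfin : μH[2] (φ '' T2) ≠ ⊤ := by
    refine ne_top_of_le_ne_top ?_ (hlip.hausdorffMeasure_image_le (d := 2) (by norm_num) T2)
    rw [muH2]
    refine ENNReal.mul_ne_top ?_ T2_compact.measure_ne_top
    exact ENNReal.rpow_ne_top_of_nonneg (by norm_num) (by simp)
  have hint : IntegrableOn (fun x => g x * g x) (φ '' T2) μH[2] :=
    (hg.mul hg).continuousOn.integrableOn_of_subset_isCompact hcomp hcomp.measurableSet
      subset_rfl hfin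
  rw [setIntegral_eq_zero_iff_of_nonneg_ae
    (Filter.Eventually.of_forall fun x => mul_self_nonneg _) hint] at h
  rw [Filter.EventuallyEq, ae_restrict_iff' hcomp.measurableSet, ae_iff] at h
  rintro _ ⟨p, hp, rfl⟩
  by_contra hne
  set U : Set (Fin 2 → ℝ) := {q | g (φ q) ≠ 0} with hU
  have hUo : IsOpen U := isOpen_ne_fun (hg.comp hlip.continuous) continuous_const
  have hpc : p ∈ closure (interior T2) := by
    rw [T2_convex.closure_interior_eq_closure_of_nonempty_interior T2_interior]
    exact subset_closure hp
  have hn : (U ∩ interior T2).Nonempty := mem_closure_iff.1 hpc U hUo hne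
  have hpos := (hUo.inter isOpen_interior).measure_pos volume hn
  have hle := hanti'.le_hausdorffMeasure_image (d := 2) (by norm_num) (U ∩ interior T2)
  have hz : μH[2] (φ '' (U ∩ interior T2)) = 0 := by
    refine measure_mono_null ?_ h
    rintro _ ⟨q, ⟨hq, hq'⟩, rfl⟩ hcon
    exact hq (mul_self_eq_zero.1 (hcon ⟨q, interior_subset hq', rfl⟩))
  rw [hz, mul_zero, muH2] at hle
  exact absurd hle (not_le.2 hpos)

lemma quad_affine (w : Fin 3 → E3) (g : E3 → ℝ) (hg : IsQ g)
    (h01 : g (midpoint ℝ (w 0) (w 1)) * 2 = g (w 0) + g (w 1))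
    (h02 : g (midpoint ℝ (w 0) (w 2)) * 2 = g (w 0) + g (w 2))
    (h12 : g (midpoint ℝ (w 1) (w 2)) * 2 = g (w 1) + g (w 2)) :
    ∃ q : E3 →ᵃ[ℝ] ℝ, ∀ x ∈ convexHull ℝ (Set.range w), g x = q x := by
  obtain ⟨c, l, M, h⟩ := hg
  obtain ⟨u, hu⟩ : ∃ u, u = w 1 - w 0 := ⟨_, rfl⟩
  obtain ⟨v, hv⟩ : ∃ v, v = w 2 - w 0 := ⟨_, rfl⟩
  have w1 : w 1 = w 0 + u := by rw [hu]; abel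
  have w2 : w 2 = w 0 + v := by rw [hv]; abel
  rw [midpoint_eq_smul_add, h, h, h, w1] at h01
  rw [midpoint_eq_smul_add, h, h, h, w2] at h02
  rw [midpoint_eq_smul_add, h, h, h, w1, w2] at h12
  simp only [map_add, map_smul, LinearMap.add_apply, LinearMap.smul_apply, smul_eq_mul,
    invOf_eq_inv] at h01 h02 h12
  have huu : M u u = 0 := by linarith
  have hvv : M v v = 0 := by linarith
  have huv : M u v + M v u = 0 := by linarith
  let Λ : E3 →ₗ[ℝ] ℝ := l + M (w 0) + M.flip (w 0)
  refine ⟨Λ.toAffineMap + AffineMap.const ℝ E3 (g (w 0) - Λ (w 0)), ?_⟩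
  rw [hull_eq, ← hu, ← hv]
  rintro _ ⟨p, _, rfl⟩
  rw [phi_eq]
  simp only [AffineMap.coe_add, Pi.add_apply, LinearMap.coe_toAffineMap, AffineMap.coe_const,
    Function.const_apply, h, Λ, map_add, map_smul, LinearMap.add_apply, LinearMap.smul_apply,
    smul_eq_mul, LinearMap.flip_apply, huu, hvv]
  linear_combination p 0 * p 1 * huv

lemma face_mid (w : Fin 3 → E3) (a : E3) (hv : AffineIndependent ℝ ![w 0, w 1, w 2, a])
    (n : E3) (hn' : ∀ i j : Fin 3, ⟪w i - w j, n⟫ = 0)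
    (σ : E3 → Matrix (Fin 3) (Fin 3) ℝ) (hσ : MemSigmaK ![w 0, w 1, w 2, a] σ) :
    nn n (σ (midpoint ℝ (w 0) (w 1))) * 2 = nn n (σ (w 0)) + nn n (σ (w 1)) ∧
    nn n (σ (midpoint ℝ (w 0) (w 2))) * 2 = nn n (σ (w 0)) + nn n (σ (w 2)) ∧
    nn n (σ (midpoint ℝ (w 1) (w 2))) * 2 = nn n (σ (w 1)) + nn n (σ (w 2)) :=
  ⟨edge_mid _ σ hσ n 0 1 (by decide) (hv.injective.ne (by decide)) (hn' 1 0),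
   edge_mid _ σ hσ n 0 2 (by decide) (hv.injective.ne (by decide)) (hn' 2 0),
   edge_mid _ σ hσ n 1 2 (by decide) (hv.injective.ne (by decide)) (hn' 2 1)⟩

lemma nn_sub (n : E3) (A B : Matrix (Fin 3) (Fin 3) ℝ) : nn n (A - B) = nn n A - nn n B := by
  rw [nn, Matrix.sub_mulVec, dotProduct_sub]; rfl

/-- Normal–normal continuity across a shared face: if two tetrahedra `K₁, K₂` share
the face `f` with vertices `w 0, w 1, w 2` and unit normal `n`, `σ₁ ∈ Σ_{K₁}`,
`σ₂ ∈ Σ_{K₂}`, and the jump `σ₁ - σ₂` has vanishing moments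
`∫_f (σ₁ - σ₂) n · v ds = 0` against all `v ∈ P₁(f;ℝ³)`, then `nᵀ σ₁ n = nᵀ σ₂ n`
everywhere on `f`. -/
theorem stmt_8 (w : Fin 3 → E3) (a b : E3)
    (hv₁ : AffineIndependent ℝ ![w 0, w 1, w 2, a])
    (hv₂ : AffineIndependent ℝ ![w 0, w 1, w 2, b])
    (n : E3) (hn : ‖n‖ = 1)
    (hn' : ∀ i j : Fin 3, ⟪w i - w j, n⟫ = 0)
    (σ₁ σ₂ : E3 → Matrix (Fin 3) (Fin 3) ℝ)
    (hσ₁ : MemSigmaK ![w 0, w 1, w 2, a] σ₁)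
    (hσ₂ : MemSigmaK ![w 0, w 1, w 2, b] σ₂)
    (hjump : ∀ ψ : Fin 3 → (E3 →ᵃ[ℝ] ℝ),
      ∫ x in convexHull ℝ (Set.range w),
        (((σ₁ x - σ₂ x).mulVec (fun r => n r)) ⬝ᵥ (fun r => ψ r x)) ∂μH[2] = 0) :
    ∀ x ∈ convexHull ℝ (Set.range w),
      (fun r => n r) ⬝ᵥ ((σ₁ x).mulVec (fun r => n r)) =
      (fun r => n r) ⬝ᵥ ((σ₂ x).mulVec (fun r => n r)) := by
  have hQ : IsQ (fun x => nn n (σ₁ x - σ₂ x)) := by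
    have := (nn_isQ n σ₁ hσ₁.1).add ((nn_isQ n σ₂ hσ₂.1).smul (-1))
    convert this using 2 with x
    rw [nn_sub]; ring
  obtain ⟨a1, a2, a3⟩ := face_mid w a hv₁ n hn' σ₁ hσ₁
  obtain ⟨b1, b2, b3⟩ := face_mid w b hv₂ n hn' σ₂ hσ₂
  obtain ⟨q, hq⟩ := quad_affine w _ hQ (by simp only [nn_sub]; linarith)
    (by simp only [nn_sub]; linarith) (by simp only [nn_sub]; linarith)
  have hmeas : MeasurableSet (convexHull ℝ (Set.range w)) :=
    ((Set.finite_range w).isCompact_convexHull (𝕜 := ℝ)).measurableSet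
  have hI := hjump (fun r => n r • q)
  have hI' : ∫ x in convexHull ℝ (Set.range w),
      nn n (σ₁ x - σ₂ x) * nn n (σ₁ x - σ₂ x) ∂μH[2] = 0 := by
    rw [← hI]
    refine setIntegral_congr_fun hmeas fun x hx => ?_
    have e : (fun r => (n r • q) x) = q x • (fun r => n r) := by
      funext r
      simp [mul_comm]
    have := hq x hx
    simp only at this ⊢
    rw [e, dotProduct_smul, ← this, smul_eq_mul, dotProduct_comm]
    rfl
  intro x hx
  have := vanish w a hv₁ _ hQ.continuous hI' x hx
  simp only [nn_sub] at this
  exact sub_eq_zero.1 this
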